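/- Let α1 ∈ K and let L be the two-sided ideal of D_3(α1,3α1) generated by a−b and b−c. Then L is a nilpotent ideal, and the quotient algebra D_3(α1,3α1)/L is 2-dimensional over K and isomorphic as a K-algebra to K[X]/(X² − α1). -/

import Mathlib

noncomputable section

open FreeAlgebra

/-- The defining relations of the PBW deformation `D₃(α₁, α₂)` of the Fomin–Kirillov
algebra `E₃`: with generators `a = ι K 0`, `b = ι K 1`, `c = ι K 2`, the relations are
`a² = b² = c² = α₁`, `ca + bc + ab = α₂` and `cb + ba + ac = α₂`. -/
inductive D3Rel (K : Type) [Field K] (α1 α2 : K) :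
    FreeAlgebra K (Fin 3) → FreeAlgebra K (Fin 3) → Prop
  | ra : D3Rel K α1 α2 (ι K (0 : Fin 3) * ι K (0 : Fin 3))
      (algebraMap K (FreeAlgebra K (Fin 3)) α1)
  | rb : D3Rel K α1 α2 (ι K (1 : Fin 3) * ι K (1 : Fin 3))
      (algebraMap K (FreeAlgebra K (Fin 3)) α1)
  | rc : D3Rel K α1 α2 (ι K (2 : Fin 3) * ι K (2 : Fin 3))
      (algebraMap K (FreeAlgebra K (Fin 3)) α1)
  | r1 : D3Rel K α1 α2
      (ι K (2 : Fin 3) * ι K (0 : Fin 3) + ι K (1 : Fin 3) * ι K (2 : Fin 3) +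
        ι K (0 : Fin 3) * ι K (1 : Fin 3))
      (algebraMap K (FreeAlgebra K (Fin 3)) α2)
  | r2 : D3Rel K α1 α2
      (ι K (2 : Fin 3) * ι K (1 : Fin 3) + ι K (1 : Fin 3) * ι K (0 : Fin 3) +
        ι K (0 : Fin 3) * ι K (2 : Fin 3))
      (algebraMap K (FreeAlgebra K (Fin 3)) α2)

/-- The algebra `D₃(α₁, α₂)`: the quotient of the free algebra `K⟨a,b,c⟩` by the two-sided
ideal generated by the relations above. -/
abbrev D3 (K : Type) [Field K] (α1 α2 : K) : Type := RingQuot (D3Rel K α1 α2)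

/-- The generator `a` of `D₃(α₁, α₂)`. -/
def D3a (K : Type) [Field K] (α1 α2 : K) : D3 K α1 α2 :=
  RingQuot.mkAlgHom K (D3Rel K α1 α2) (ι K (0 : Fin 3))

/-- The generator `b` of `D₃(α₁, α₂)`. -/
def D3b (K : Type) [Field K] (α1 α2 : K) : D3 K α1 α2 :=
  RingQuot.mkAlgHom K (D3Rel K α1 α2) (ι K (1 : Fin 3))

/-- The generator `c` of `D₃(α₁, α₂)`. -/
def D3c (K : Type) [Field K] (α1 α2 : K) : D3 K α1 α2 :=
  RingQuot.mkAlgHom K (D3Rel K α1 α2) (ι K (2 : Fin 3))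
/-- The relations of `D₃(r, 3r)` rewritten in the generators
`a`, `x = a - b`, `y = b - c`. -/
theorem difference_relations {A : Type*} [Ring A] {a b c r : A} (ha : a * a = r)
    (hb : b * b = r) (hc : c * c = r) (h1 : c * a + b * c + a * b = 3 * r)
    (h2 : c * b + b * a + a * c = 3 * r) :
    (b - c) * (a - b) = (a - b) * (b - c) ∧
      (b - c) * (b - c) = -((a - b) * (a - b)) - (a - b) * (b - c) ∧
      (a - b) * a = (a - b) * (a - b) - a * (a - b) ∧
      (b - c) * a = (a - b) * (b - c) - (a - b) * (a - b) - a * (b - c) := by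
  refine ⟨?_, ?_, ?_, ?_⟩
  · linear_combination (norm := noncomm_ring) h2 - h1
  · linear_combination (norm := noncomm_ring) ha + hb + hc - h2
  · linear_combination (norm := noncomm_ring) ha - hb
  · linear_combination (norm := noncomm_ring) ha + hb + hb - h1

section

variable {A : Type*} [Ring A] {a x y : A}

theorem two_mul_cube_eq_zero (hyx : y * x = x * y) (hxa : x * a = x * x - a * x)
    (hya : y * a = x * y - x * x - a * y) : x * x * x + x * x * x = 0 := by
  linear_combination (norm := noncomm_ring)
    hyx * a - y * hxa + hya * x + x * hya - hxa * y - hyx * x - a * hyx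

variable {K : Type*} [Field K] [Algebra K A]

theorem span_mul_mem_of_adjoin_eq_top {G S : Set A} (hG : Algebra.adjoin K G = ⊤)
    (h : ∀ s ∈ S, ∀ g ∈ G, s * g ∈ Ideal.span S) {m : A} (hm : m ∈ Ideal.span S) (d : A) :
    m * d ∈ Ideal.span S := by
  have hd : d ∈ Algebra.adjoin K G := hG ▸ Algebra.mem_top
  induction hd using Algebra.adjoin_induction generalizing m with
  | mem g hg =>
    induction hm using Submodule.span_induction with
    | mem s hs => exact h s hs g hg
    | zero => simp
    | add m n _ _ hm hn => rw [add_mul]; exact add_mem hm hn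
    | smul t m _ hm => rw [smul_eq_mul, mul_assoc]; exact Ideal.mul_mem_left _ _ hm
  | algebraMap k => rw [← Algebra.commutes]; exact Ideal.mul_mem_left _ _ hm
  | add d e _ _ hd he => rw [mul_add]; exact add_mem (hd hm) (he hm)
  | mul d e _ _ hd he => rw [← mul_assoc]; exact he (hd hm)

theorem span_mul_mem_span {S T : Set A} (hS : ∀ m ∈ Ideal.span S, ∀ d, m * d ∈ Ideal.span S)
    (hx : ∀ s ∈ S, s * x ∈ Ideal.span T) (hy : ∀ s ∈ S, s * y ∈ Ideal.span T) {m l : A}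
    (hm : m ∈ Ideal.span S) (hl : l ∈ Ideal.span {x, y}) : m * l ∈ Ideal.span T := by
  have key : ∀ z, (∀ s ∈ S, s * z ∈ Ideal.span T) → ∀ m ∈ Ideal.span S, m * z ∈ Ideal.span T := by
    intro z hz m hm
    induction hm using Submodule.span_induction with
    | mem s hs => exact hz s hs
    | zero => simp
    | add m n _ _ hm hn => rw [add_mul]; exact add_mem hm hn
    | smul t m _ hm => rw [smul_eq_mul, mul_assoc]; exact Ideal.mul_mem_left _ _ hm
  obtain ⟨u, v, rfl⟩ := Submodule.mem_span_pair.1 hl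
  rw [smul_eq_mul, smul_eq_mul, mul_add, ← mul_assoc, ← mul_assoc]
  exact add_mem (key x hx _ (hS m hm u)) (key y hy _ (hS m hm v))

theorem twoSidedIdeal_span_pair_le (h : ∀ m ∈ Ideal.span {x, y}, ∀ d, m * d ∈ Ideal.span {x, y})
    {l : A} (hl : l ∈ TwoSidedIdeal.span {x, y}) : l ∈ Ideal.span {x, y} := by
  let I : TwoSidedIdeal A := .mk' (Ideal.span {x, y}) (zero_mem _) add_mem neg_mem
    (fun h => Ideal.mul_mem_left _ _ h) (fun hm => h _ hm _)
  have hI : l ∈ I := TwoSidedIdeal.span_le.2 (fun z hz => by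
    simpa [I] using Ideal.subset_span hz) hl
  simpa [I] using hI

/-- Four-fold products vanish in the two-sided ideal generated by `x` and `y`. -/
theorem mul_mul_mul_eq_zero_of_mem_span_pair (h2 : (2 : K) ≠ 0)
    (hgen : Algebra.adjoin K {a, x, y} = ⊤) (hyx : y * x = x * y)
    (hyy : y * y = -(x * x) - x * y) (hxa : x * a = x * x - a * x)
    (hya : y * a = x * y - x * x - a * y) {l₁ l₂ l₃ l₄ : A}
    (hl₁ : l₁ ∈ TwoSidedIdeal.span {x, y}) (hl₂ : l₂ ∈ TwoSidedIdeal.span {x, y})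
    (hl₃ : l₃ ∈ TwoSidedIdeal.span {x, y}) (hl₄ : l₄ ∈ TwoSidedIdeal.span {x, y}) :
    l₁ * l₂ * l₃ * l₄ = 0 := by
  have hxxx : x * x * x = 0 := by
    have h := two_mul_cube_eq_zero hyx hxa hya
    rw [← two_smul K] at h
    exact (smul_eq_zero_iff_right h2).1 h
  have hxyx : x * y * x = x * x * y := by
    linear_combination (norm := noncomm_ring) x * hyx
  have hxyy : x * y * y = -(x * x * y) := by
    linear_combination (norm := noncomm_ring) x * hyy - hxxx
  have hxxa : x * x * a = a * (x * x) := by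
    linear_combination (norm := noncomm_ring) x * hxa - hxa * x
  have hxya : x * y * a = a * (x * y) := by
    linear_combination (norm := noncomm_ring) x * hya - hxa * y - hxxx
  have hxxyx : x * x * y * x = 0 := by
    linear_combination (norm := noncomm_ring) x * x * hyx + hxxx * y
  have hxxyy : x * x * y * y = 0 := by
    linear_combination (norm := noncomm_ring) x * x * hyy - hxxx * x - hxxx * y
  have hxxya : x * x * y * a = -(a * (x * x * y)) := by
    linear_combination (norm := noncomm_ring)
      x * hxya + hxa * x * y + hxxx * y
  have comb : ∀ u v p q : A, u * p + v * q ∈ Ideal.span {p, q} := fun u v p q =>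
    Submodule.mem_span_pair.2 ⟨u, v, rfl⟩
  have single : ∀ u p : A, u * p ∈ Ideal.span {p} := fun u p =>
    Submodule.mem_span_singleton.2 ⟨u, rfl⟩
  have hJ₁ : ∀ m ∈ Ideal.span {x, y}, ∀ d, m * d ∈ Ideal.span {x, y} := by
    refine fun m hm d => span_mul_mem_of_adjoin_eq_top hgen ?_ hm d
    rintro s (rfl | rfl) g (rfl | rfl | rfl)
    · rw [hxa, ← sub_mul]; simpa using comb (s - g) 0 s y
    · exact Ideal.mul_mem_left _ _ (Ideal.subset_span (by simp))
    · exact Ideal.mul_mem_left _ _ (Ideal.subset_span (by simp))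
    · rw [hya]; convert comb (-x) (x - g) x s using 1; noncomm_ring
    · exact Ideal.mul_mem_left _ _ (Ideal.subset_span (by simp))
    · exact Ideal.mul_mem_left _ _ (Ideal.subset_span (by simp))
  have hJ₂ : ∀ m ∈ Ideal.span {x * x, x * y}, ∀ d, m * d ∈ Ideal.span {x * x, x * y} := by
    refine fun m hm d => span_mul_mem_of_adjoin_eq_top hgen ?_ hm d
    rintro s (rfl | rfl) g (rfl | rfl | rfl)
    · rw [hxxa]; exact Ideal.mul_mem_left _ _ (Ideal.subset_span (by simp))
    · rw [hxxx]; exact zero_mem _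
    · rw [mul_assoc]; exact Ideal.mul_mem_left _ _ (Ideal.subset_span (by simp))
    · rw [hxya]; exact Ideal.mul_mem_left _ _ (Ideal.subset_span (by simp))
    · rw [hxyx, mul_assoc]; exact Ideal.mul_mem_left _ _ (Ideal.subset_span (by simp))
    · rw [hxyy, mul_assoc]
      exact neg_mem (Ideal.mul_mem_left _ _ (Ideal.subset_span (by simp)))
  have hJ₃ : ∀ m ∈ Ideal.span {x * x * y}, ∀ d, m * d ∈ Ideal.span {x * x * y} := by
    refine fun m hm d => span_mul_mem_of_adjoin_eq_top hgen ?_ hm d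
    rintro s rfl g (rfl | rfl | rfl)
    · rw [hxxya]; exact neg_mem (single _ _)
    · rw [hxxyx]; exact zero_mem _
    · rw [hxxyy]; exact zero_mem _
  have h₂ : l₁ * l₂ ∈ Ideal.span {x * x, x * y} := by
    refine span_mul_mem_span hJ₁ ?_ ?_ (twoSidedIdeal_span_pair_le hJ₁ hl₁)
      (twoSidedIdeal_span_pair_le hJ₁ hl₂)
    · rintro s (rfl | rfl)
      · exact Ideal.subset_span (by simp)
      · rw [hyx]; exact Ideal.subset_span (by simp)
    · rintro s (rfl | rfl)
      · exact Ideal.subset_span (by simp)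
      · rw [hyy]
        exact sub_mem (neg_mem (Ideal.subset_span (by simp))) (Ideal.subset_span (by simp))
  have h₃ : l₁ * l₂ * l₃ ∈ Ideal.span {x * x * y} := by
    refine span_mul_mem_span hJ₂ ?_ ?_ h₂ (twoSidedIdeal_span_pair_le hJ₁ hl₃)
    · rintro s (rfl | rfl)
      · rw [hxxx]; exact zero_mem _
      · rw [hxyx]; exact Ideal.subset_span (by simp)
    · rintro s (rfl | rfl)
      · exact Ideal.subset_span (by simp)
      · rw [hxyy]; exact neg_mem (Ideal.subset_span (by simp))
  have h₄ : l₁ * l₂ * l₃ * l₄ ∈ Ideal.span ∅ := by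
    refine span_mul_mem_span hJ₃ ?_ ?_ h₃ (twoSidedIdeal_span_pair_le hJ₁ hl₄)
    · rintro s rfl
      rw [hxxyx]; exact zero_mem _
    · rintro s rfl
      rw [hxxyy]; exact zero_mem _
  simpa using h₄

end

section

variable (K : Type) [Field K] (α1 α2 : K)

theorem D3a_mul_self : D3a K α1 α2 * D3a K α1 α2 = algebraMap K _ α1 := by
  simpa using! RingQuot.mkAlgHom_rel K (D3Rel.ra (K := K) (α1 := α1) (α2 := α2))

theorem D3b_mul_self : D3b K α1 α2 * D3b K α1 α2 = algebraMap K _ α1 := by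
  simpa using! RingQuot.mkAlgHom_rel K (D3Rel.rb (K := K) (α1 := α1) (α2 := α2))

theorem D3c_mul_self : D3c K α1 α2 * D3c K α1 α2 = algebraMap K _ α1 := by
  simpa using! RingQuot.mkAlgHom_rel K (D3Rel.rc (K := K) (α1 := α1) (α2 := α2))

theorem D3_ca_add_bc_add_ab : D3c K α1 α2 * D3a K α1 α2 + D3b K α1 α2 * D3c K α1 α2 +
    D3a K α1 α2 * D3b K α1 α2 = algebraMap K _ α2 := by
  simpa using! RingQuot.mkAlgHom_rel K (D3Rel.r1 (K := K) (α1 := α1) (α2 := α2))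

theorem D3_cb_add_ba_add_ac : D3c K α1 α2 * D3b K α1 α2 + D3b K α1 α2 * D3a K α1 α2 +
    D3a K α1 α2 * D3c K α1 α2 = algebraMap K _ α2 := by
  simpa using! RingQuot.mkAlgHom_rel K (D3Rel.r2 (K := K) (α1 := α1) (α2 := α2))

theorem D3_adjoin_eq_top : Algebra.adjoin K
    {D3a K α1 α2, D3a K α1 α2 - D3b K α1 α2, D3b K α1 α2 - D3c K α1 α2} = ⊤ := by
  set B := Algebra.adjoin K
    {D3a K α1 α2, D3a K α1 α2 - D3b K α1 α2, D3b K α1 α2 - D3c K α1 α2}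
  have ha : D3a K α1 α2 ∈ B := Algebra.subset_adjoin (by simp)
  have hx : D3a K α1 α2 - D3b K α1 α2 ∈ B := Algebra.subset_adjoin (by simp)
  have hy : D3b K α1 α2 - D3c K α1 α2 ∈ B := Algebra.subset_adjoin (by simp)
  have hb : D3b K α1 α2 ∈ B := by simpa using sub_mem ha hx
  have hc : D3c K α1 α2 ∈ B := by simpa using sub_mem hb hy
  refine eq_top_iff.2 fun z _ => ?_
  obtain ⟨w, rfl⟩ := RingQuot.mkAlgHom_surjective K (D3Rel K α1 α2) z
  induction w using FreeAlgebra.induction with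
  | grade0 r => rw [AlgHom.commutes]; exact B.algebraMap_mem r
  | grade1 i => fin_cases i; exacts [ha, hb, hc]
  | mul u v hu hv => rw [map_mul]; exact mul_mem (hu trivial) (hv trivial)
  | add u v hu hv => rw [map_add]; exact add_mem (hu trivial) (hv trivial)

variable {K α1 α2} in
/-- The universal property of `D₃(α₁, α₂)`. -/
def D3Lift {B : Type*} [Ring B] [Algebra K B] (a b c : B)
    (ha : a * a = algebraMap K B α1) (hb : b * b = algebraMap K B α1)
    (hc : c * c = algebraMap K B α1) (h1 : c * a + b * c + a * b = algebraMap K B α2)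
    (h2 : c * b + b * a + a * c = algebraMap K B α2) : D3 K α1 α2 →ₐ[K] B :=
  RingQuot.liftAlgHom K ⟨FreeAlgebra.lift K ![a, b, c], by
    rintro _ _ (_ | _ | _ | _ | _) <;> simpa⟩

/-- The quotient of `D₃(α₁, α₂)` by the ideal generated by `a - b` and `b - c`. -/
abbrev D3Quot : Type :=
  RingQuot (fun x y : D3 K α1 α2 =>
    (x = D3a K α1 α2 - D3b K α1 α2 ∨ x = D3b K α1 α2 - D3c K α1 α2) ∧ y = 0)

/-- The projection of `D₃(α₁, α₂)` onto its quotient. -/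
abbrev D3QuotMk : D3 K α1 α2 →ₐ[K] D3Quot K α1 α2 := RingQuot.mkAlgHom K _

theorem D3QuotMk_D3b : D3QuotMk K α1 α2 (D3b K α1 α2) = D3QuotMk K α1 α2 (D3a K α1 α2) := by
  have h : D3QuotMk K α1 α2 (D3a K α1 α2 - D3b K α1 α2) = D3QuotMk K α1 α2 0 :=
    RingQuot.mkAlgHom_rel K ⟨.inl rfl, rfl⟩
  rw [map_sub, map_zero, sub_eq_zero] at h
  exact h.symm

theorem D3QuotMk_D3c : D3QuotMk K α1 α2 (D3c K α1 α2) = D3QuotMk K α1 α2 (D3a K α1 α2) := by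
  have h : D3QuotMk K α1 α2 (D3b K α1 α2 - D3c K α1 α2) = D3QuotMk K α1 α2 0 :=
    RingQuot.mkAlgHom_rel K ⟨.inr rfl, rfl⟩
  rw [map_sub, map_zero, sub_eq_zero, D3QuotMk_D3b] at h
  exact h.symm

/-- The map `D₃(α₁, 3α₁)/L → K[X]/(X² - α₁)` sending `a`, `b` and `c` to `X`. -/
def D3QuotToAdjoinRoot :
    D3Quot K α1 (3 * α1) →ₐ[K] AdjoinRoot (Polynomial.X ^ 2 - Polynomial.C α1) :=
  have hroot : AdjoinRoot.root (Polynomial.X ^ 2 - Polynomial.C α1) *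
      AdjoinRoot.root (Polynomial.X ^ 2 - Polynomial.C α1) = algebraMap K _ α1 := by
    have h := AdjoinRoot.eval₂_root (Polynomial.X ^ 2 - Polynomial.C α1)
    simpa [sub_eq_zero, pow_two] using h
  RingQuot.liftAlgHom K ⟨D3Lift (AdjoinRoot.root _) (AdjoinRoot.root _) (AdjoinRoot.root _)
    hroot hroot hroot (by rw [hroot, map_mul, map_ofNat]; ring)
    (by rw [hroot, map_mul, map_ofNat]; ring), by
      rintro _ _ ⟨rfl | rfl, rfl⟩ <;> simp [D3Lift, D3a, D3b, D3c]⟩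

theorem D3QuotToAdjoinRoot_D3a :
    D3QuotToAdjoinRoot K α1 (D3QuotMk K α1 (3 * α1) (D3a K α1 (3 * α1))) =
      AdjoinRoot.root _ := by
  rw [D3QuotToAdjoinRoot, RingQuot.liftAlgHom_mkAlgHom_apply]
  simp [D3Lift, D3a]

/-- The map `K[X]/(X² - α₁) → D₃(α₁, α₂)/L` sending `X` to `a`. -/
def adjoinRootToD3Quot :
    AdjoinRoot (Polynomial.X ^ 2 - Polynomial.C α1) →ₐ[K] D3Quot K α1 α2 :=
  Ideal.Quotient.liftₐ _ (Polynomial.aeval (D3QuotMk K α1 α2 (D3a K α1 α2))) (by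
    intro p hp
    obtain ⟨q, rfl⟩ := Ideal.mem_span_singleton'.1 hp
    rw [map_mul, map_sub, map_pow, Polynomial.aeval_X, Polynomial.aeval_C, pow_two, ← map_mul,
      D3a_mul_self, AlgHom.commutes, sub_self, mul_zero])

theorem adjoinRootToD3Quot_root : adjoinRootToD3Quot K α1 α2 (AdjoinRoot.root _) =
    D3QuotMk K α1 α2 (D3a K α1 α2) :=
  Polynomial.aeval_X _

/-- The quotient `D₃(α₁, 3α₁)/L` is isomorphic to `K[X]/(X² - α₁)`. -/
def D3QuotEquiv :
    D3Quot K α1 (3 * α1) ≃ₐ[K] AdjoinRoot (Polynomial.X ^ 2 - Polynomial.C α1) :=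
  AlgEquiv.ofAlgHom (D3QuotToAdjoinRoot K α1) (adjoinRootToD3Quot K α1 (3 * α1))
    (AdjoinRoot.algHom_ext (by
      simp [adjoinRootToD3Quot_root, D3QuotToAdjoinRoot_D3a])) (by
    have hxa : (adjoinRootToD3Quot K α1 (3 * α1)).comp (D3QuotToAdjoinRoot K α1)
        (D3QuotMk K α1 (3 * α1) (D3a K α1 (3 * α1))) =
          D3QuotMk K α1 (3 * α1) (D3a K α1 (3 * α1)) := by
      rw [AlgHom.comp_apply, D3QuotToAdjoinRoot_D3a, adjoinRootToD3Quot_root]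
    refine RingQuot.ringQuot_ext' K _ _ (RingQuot.ringQuot_ext' K _ _
      (FreeAlgebra.hom_ext (funext fun i => ?_)))
    fin_cases i
    · exact hxa
    · have := hxa
      rw [← D3QuotMk_D3b] at this
      exact this
    · have := hxa
      rw [← D3QuotMk_D3c] at this
      exact this)

theorem finrank_adjoinRoot_X_sq_sub_C :
    Module.finrank K (AdjoinRoot (Polynomial.X ^ 2 - Polynomial.C α1)) = 2 := by
  rw [(AdjoinRoot.powerBasis (Polynomial.X_pow_sub_C_ne_zero two_pos α1)).finrank,
    AdjoinRoot.powerBasis_dim, Polynomial.natDegree_X_pow_sub_C]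

end

theorem D3_nilpotent_ideal (K : Type) [Field K] [IsAlgClosed K] (hchar : ringChar K ≠ 2)
    (α1 : K) :
    let a := D3a K α1 (3 * α1)
    let b := D3b K α1 (3 * α1)
    let c := D3c K α1 (3 * α1)
    let L := TwoSidedIdeal.span ({a - b, b - c} : Set (D3 K α1 (3 * α1)))
    -- `L` is nilpotent
    (∃ n : ℕ, 0 < n ∧ ∀ f : Fin n → D3 K α1 (3 * α1),
      (∀ i, f i ∈ L) → (List.ofFn f).prod = 0) ∧
    -- the quotient `D₃(α₁, 3α₁)/L` is 2-dimensional and isomorphic to `K[X]/(X² - α₁)`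
    Module.finrank K (RingQuot (fun x y : D3 K α1 (3 * α1) =>
      (x = a - b ∨ x = b - c) ∧ y = 0)) = 2 ∧
    Nonempty ((RingQuot (fun x y : D3 K α1 (3 * α1) =>
      (x = a - b ∨ x = b - c) ∧ y = 0)) ≃ₐ[K]
        AdjoinRoot (Polynomial.X ^ 2 - Polynomial.C α1)) := by
  intro a b c L
  refine ⟨⟨4, by norm_num, fun f hf => ?_⟩, ?_, ⟨D3QuotEquiv K α1⟩⟩
  · have h3 : algebraMap K (D3 K α1 (3 * α1)) (3 * α1) = 3 * algebraMap K _ α1 := by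
      rw [map_mul, map_ofNat]
    obtain ⟨hyx, hyy, hxa, hya⟩ := difference_relations (D3a_mul_self K α1 (3 * α1))
      (D3b_mul_self K α1 (3 * α1)) (D3c_mul_self K α1 (3 * α1))
      ((D3_ca_add_bc_add_ab K α1 (3 * α1)).trans h3)
      ((D3_cb_add_ba_add_ac K α1 (3 * α1)).trans h3)
    have h := mul_mul_mul_eq_zero_of_mem_span_pair (Ring.two_ne_zero hchar)
      (D3_adjoin_eq_top K α1 (3 * α1)) hyx hyy hxa hya (hf 0) (hf 1) (hf 2) (hf 3)
    simpa [List.ofFn_succ, mul_assoc] using! h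
  · exact (D3QuotEquiv K α1).toLinearEquiv.finrank_eq.trans (finrank_adjoinRoot_X_sq_sub_C K α1)
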